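/- Under Condition 3 with 0 < d₁ < 1, there is a constant M such that |(m/n)·μ_{J,p} − μ_p| ≤ M/p for all sufficiently large p; in particular p^{2/3}·|(m/n)·μ_{J,p} − μ_p| → 0 as p → ∞. -/

import Mathlib

open MeasureTheory Filter

/-- Left edge of the Marchenko–Pastur type law with ratio `d`. -/
noncomputable def aMP (d : ℝ) : ℝ := (1 - Real.sqrt d) ^ 2

/-- Right edge of the Marchenko–Pastur type law with ratio `d`. -/
noncomputable def bMP (d : ℝ) : ℝ := (1 + Real.sqrt d) ^ 2

/-- The Marchenko–Pastur type density `ϱ_d`. -/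
noncomputable def rhoMP (d x : ℝ) : ℝ :=
  if aMP d ≤ x ∧ x ≤ bMP d then
    (1 / (2 * Real.pi * d * x)) * Real.sqrt ((bMP d - x) * (x - aMP d))
  else 0

section Centering

open Real Set Topology

section SemicircleIntegrals

variable {a b c x : ℝ}

private lemma hasDerivAt_sqrt_mul (ha : a < x) (hb : x < b) :
    HasDerivAt (fun x => √((b - x) * (x - a))) ((a + b - 2 * x) / (2 * √((b - x) * (x - a)))) x := by
  have h : (b - x) * (x - a) ≠ 0 := (mul_pos (sub_pos.2 hb) (sub_pos.2 ha)).ne'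
  convert (((hasDerivAt_id' x).const_sub b).fun_mul ((hasDerivAt_id' x).sub_const a)).sqrt h using 1
  ring

private lemma hasDerivAt_arcsin_affine (ha : a < x) (hb : x < b) :
    HasDerivAt (fun x => arcsin ((2 * x - a - b) / (b - a))) (1 / √((b - x) * (x - a))) x := by
  have hab : 0 < b - a := by linarith
  have hQ : 0 < (b - x) * (x - a) := mul_pos (sub_pos.2 hb) (sub_pos.2 ha)
  have h1 : (2 * x - a - b) / (b - a) ≠ -1 := by
    rw [Ne, div_eq_iff hab.ne']; intro h; linarith
  have h2 : (2 * x - a - b) / (b - a) ≠ 1 := by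
    rw [Ne, div_eq_iff hab.ne']; intro h; linarith
  have hd : HasDerivAt (fun x => (2 * x - a - b) / (b - a)) (2 / (b - a)) x := by
    simpa using ((((hasDerivAt_id x).const_mul 2).sub_const a).sub_const b).div_const (b - a)
  have hs : √(1 - ((2 * x - a - b) / (b - a)) ^ 2) = 2 * √((b - x) * (x - a)) / (b - a) := by
    rw [Real.sqrt_eq_iff_mul_self_eq_of_pos (by positivity)]
    field_simp
    rw [Real.sq_sqrt hQ.le]
    ring
  refine ((hasDerivAt_arcsin h1 h2).comp x hd).congr_deriv ?_
  rw [hs]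
  have := (Real.sqrt_pos.2 hQ).ne'
  field_simp

private lemma hasDerivAt_arcsin_inv (hc : c < a) (ha : a < x) (hb : x < b) :
    HasDerivAt
      (fun x => arcsin ((2 * ((a - c) * (b - c)) / (x - c) - (a - c) - (b - c)) / (b - a)))
      (-(√((a - c) * (b - c)) / ((x - c) * √((b - x) * (x - a))))) x := by
  have hab : 0 < b - a := by linarith
  have hx : 0 < x - c := by linarith
  have hac : 0 < a - c := by linarith
  have hbc : 0 < b - c := by linarith
  have hax : 0 < x - a := by linarith
  have hbx : 0 < b - x := by linarith
  have hQ : 0 < (b - x) * (x - a) := mul_pos hbx hax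
  have hP : 0 < (a - c) * (b - c) := mul_pos hac hbc
  set P := (a - c) * (b - c) with hPdef
  have h1 : (2 * P / (x - c) - (a - c) - (b - c)) / (b - a) ≠ -1 := by
    rw [Ne, div_eq_iff hab.ne', sub_sub, sub_eq_iff_eq_add, div_eq_iff hx.ne']
    intro h
    nlinarith [mul_pos hac hbx]
  have h2 : (2 * P / (x - c) - (a - c) - (b - c)) / (b - a) ≠ 1 := by
    rw [Ne, div_eq_iff hab.ne', sub_sub, sub_eq_iff_eq_add, div_eq_iff hx.ne']
    intro h
    nlinarith [mul_pos hbc hax]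
  have hd : HasDerivAt (fun x => (2 * P / (x - c) - (a - c) - (b - c)) / (b - a))
      (-(2 * P) / (x - c) ^ 2 / (b - a)) x := by
    have h := ((((hasDerivAt_id' x).sub_const c).fun_inv hx.ne').const_mul (2 * P))
    refine (((h.sub_const (a - c)).sub_const (b - c)).div_const (b - a)).congr_deriv ?_
    ring
  have hs : √(1 - ((2 * P / (x - c) - (a - c) - (b - c)) / (b - a)) ^ 2)
      = 2 * (√P * √((b - x) * (x - a))) / ((x - c) * (b - a)) := by
    rw [Real.sqrt_eq_iff_mul_self_eq_of_pos (by positivity)]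
    field_simp
    rw [Real.sq_sqrt hQ.le, Real.sq_sqrt hP.le, hPdef]
    ring
  refine ((hasDerivAt_arcsin h1 h2).comp x hd).congr_deriv ?_
  rw [hs]
  have := (Real.sqrt_pos.2 hQ).ne'
  have := (Real.sqrt_pos.2 hP).ne'
  field_simp
  rw [Real.sq_sqrt hP.le]

private lemma arcsin_inv_left (hc : c < a) (hab : a < b) :
    arcsin ((2 * ((a - c) * (b - c)) / (a - c) - (a - c) - (b - c)) / (b - a)) = π / 2 := by
  have h1 : a - c ≠ 0 := by linarith
  have h2 : b - a ≠ 0 := by linarith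
  rw [← arcsin_one]
  congr 1
  field_simp
  ring

private lemma arcsin_inv_right (hc : c < a) (hab : a < b) :
    arcsin ((2 * ((a - c) * (b - c)) / (b - c) - (a - c) - (b - c)) / (b - a)) = -(π / 2) := by
  have h1 : b - c ≠ 0 := by linarith
  have h2 : b - a ≠ 0 := by linarith
  rw [← arcsin_neg_one]
  congr 1
  field_simp
  ring

private lemma arcsin_affine_left (hab : a < b) :
    arcsin ((2 * a - a - b) / (b - a)) = -(π / 2) := by
  have h2 : b - a ≠ 0 := by linarith
  rw [← arcsin_neg_one]
  congr 1
  field_simp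
  ring

private lemma arcsin_affine_right (hab : a < b) :
    arcsin ((2 * b - a - b) / (b - a)) = π / 2 := by
  have h2 : b - a ≠ 0 := by linarith
  rw [← arcsin_one]
  congr 1
  field_simp
  ring

private lemma sub_ne_zero_of_mem (hc : c < a) (hab : a < b) : ∀ x ∈ uIcc a b, x - c ≠ 0 := by
  intro x hx
  rw [uIcc_of_le hab.le] at hx
  linarith [hx.1]

lemma intervalIntegrable_sqrt_div (hc : c < a) (hab : a < b) (k : ℕ) :
    IntervalIntegrable (fun x => √((b - x) * (x - a)) / (x - c) ^ k) volume a b := by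
  apply ContinuousOn.intervalIntegrable
  refine ContinuousOn.div (by fun_prop) (by fun_prop) fun x hx => ?_
  exact pow_ne_zero _ (sub_ne_zero_of_mem hc hab x hx)

private lemma continuousOn_arcsin_inv (hc : c < a) :
    ContinuousOn
      (fun x => arcsin ((2 * ((a - c) * (b - c)) / (x - c) - (a - c) - (b - c)) / (b - a)))
      (Icc a b) := by
  refine continuous_arcsin.comp_continuousOn ?_
  have : ContinuousOn (fun x => 2 * ((a - c) * (b - c)) / (x - c)) (Icc a b) := by
    refine ContinuousOn.div (by fun_prop) (by fun_prop) fun x hx => ?_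
    linarith [hx.1]
  fun_prop

lemma integral_sqrt_div_sub (hc : c < a) (hab : a < b) :
    ∫ x in a..b, √((b - x) * (x - a)) / (x - c)
      = π * ((a + b) / 2 - c - √((a - c) * (b - c))) := by
  have hP : 0 < (a - c) * (b - c) := mul_pos (by linarith) (by linarith)
  have hcont := continuousOn_arcsin_inv (b := b) hc
  have key := intervalIntegral.integral_eq_sub_of_hasDerivAt_of_le hab.le
    (f := fun x => √((b - x) * (x - a))
      + ((a + b) / 2 - c) * arcsin ((2 * x - a - b) / (b - a))
      + √((a - c) * (b - c)) *
        arcsin ((2 * ((a - c) * (b - c)) / (x - c) - (a - c) - (b - c)) / (b - a)))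
    (f' := fun x => √((b - x) * (x - a)) / (x - c))
    (by fun_prop) ?_ (by simpa using intervalIntegrable_sqrt_div hc hab 1)
  · rw [key, arcsin_inv_left hc hab, arcsin_inv_right hc hab, arcsin_affine_left hab,
      arcsin_affine_right hab]
    simp only [sub_self, zero_mul, mul_zero, sqrt_zero]
    ring
  · intro x hx
    have hQ : 0 < (b - x) * (x - a) := mul_pos (sub_pos.2 hx.2) (sub_pos.2 hx.1)
    have hx' : x - c ≠ 0 := by linarith [hx.1]
    refine (((hasDerivAt_sqrt_mul hx.1 hx.2).add
      ((hasDerivAt_arcsin_affine hx.1 hx.2).const_mul _)).add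
      ((hasDerivAt_arcsin_inv hc hx.1 hx.2).const_mul _)).congr_deriv ?_
    have := (Real.sqrt_pos.2 hQ).ne'
    field_simp
    rw [Real.sq_sqrt hQ.le, Real.sq_sqrt hP.le]
    ring

lemma integral_sqrt_div_sub_sq (hc : c < a) (hab : a < b) :
    ∫ x in a..b, √((b - x) * (x - a)) / (x - c) ^ 2
      = π * (((a + b) / 2 - c) / √((a - c) * (b - c)) - 1) := by
  have hP : 0 < (a - c) * (b - c) := mul_pos (by linarith) (by linarith)
  have hcont := continuousOn_arcsin_inv (b := b) hc
  have hcont' : ContinuousOn (fun x => √((b - x) * (x - a)) / (x - c)) (Icc a b) := by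
    refine ContinuousOn.div (by fun_prop) (by fun_prop) fun x hx => ?_
    linarith [hx.1]
  have key := intervalIntegral.integral_eq_sub_of_hasDerivAt_of_le hab.le
    (f := fun x => -(√((b - x) * (x - a)) / (x - c))
      - arcsin ((2 * x - a - b) / (b - a))
      - ((a + b) / 2 - c) / √((a - c) * (b - c)) *
        arcsin ((2 * ((a - c) * (b - c)) / (x - c) - (a - c) - (b - c)) / (b - a)))
    (f' := fun x => √((b - x) * (x - a)) / (x - c) ^ 2)
    (by fun_prop) ?_ (intervalIntegrable_sqrt_div hc hab 2)
  · rw [key, arcsin_inv_left hc hab, arcsin_inv_right hc hab, arcsin_affine_left hab,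
      arcsin_affine_right hab]
    simp only [sub_self, zero_mul, mul_zero, sqrt_zero, zero_div]
    ring
  · intro x hx
    have hQ : 0 < (b - x) * (x - a) := mul_pos (sub_pos.2 hx.2) (sub_pos.2 hx.1)
    have hx' : x - c ≠ 0 := by linarith [hx.1]
    have hd := (hasDerivAt_sqrt_mul hx.1 hx.2).fun_div ((hasDerivAt_id' x).sub_const c) hx'
    refine ((hd.neg.sub (hasDerivAt_arcsin_affine hx.1 hx.2)).sub
      ((hasDerivAt_arcsin_inv hc hx.1 hx.2).const_mul _)).congr_deriv ?_
    have := (Real.sqrt_pos.2 hQ).ne'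
    have := (Real.sqrt_pos.2 hP).ne'
    field_simp
    rw [Real.sq_sqrt hQ.le]
    ring

end SemicircleIntegrals

section MarchenkoPastur

variable {c d : ℝ}

lemma aMP_lt_bMP (hd : 0 < d) : aMP d < bMP d := by
  have := Real.sqrt_pos.2 hd
  unfold aMP bMP
  nlinarith

lemma aMP_pos (hd1 : d < 1) : 0 < aMP d := by
  have : √d < 1 := by rw [Real.sqrt_lt' one_pos]; simpa using hd1
  unfold aMP
  have : 0 < 1 - √d := by linarith
  positivity

lemma aMP_add_bMP (hd : 0 ≤ d) : aMP d + bMP d = 2 * (1 + d) := by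
  have := Real.sq_sqrt hd
  unfold aMP bMP
  linear_combination 2 * this

lemma aMP_mul_bMP (hd : 0 ≤ d) : aMP d * bMP d = (1 - d) ^ 2 := by
  have := Real.sq_sqrt hd
  unfold aMP bMP
  linear_combination (-2 + d + √d ^ 2) * this

lemma aMP_lt_one_sub (hd : 0 < d) (hd1 : d < 1) : aMP d < 1 - d := by
  have h1 : √d < 1 := by rw [Real.sqrt_lt' one_pos]; simpa using hd1
  have h0 := Real.sqrt_pos.2 hd
  have := Real.sq_sqrt hd.le
  unfold aMP
  nlinarith

lemma rhoMP_of_mem {x : ℝ} (hx : x ∈ Icc (aMP d) (bMP d)) :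
    rhoMP d x = 1 / (2 * π * d * x) * √((bMP d - x) * (x - aMP d)) := by
  rw [rhoMP, if_pos ⟨hx.1, hx.2⟩]

private lemma integral_sqrt_div_self (hd : 0 < d) (hd1 : d < 1) :
    ∫ x in aMP d..bMP d, √((bMP d - x) * (x - aMP d)) / x = 2 * π * d := by
  have h := integral_sqrt_div_sub (aMP_pos hd1) (aMP_lt_bMP hd)
  simp only [sub_zero] at h
  rw [h, aMP_add_bMP hd.le, aMP_mul_bMP hd.le, Real.sqrt_sq (by linarith)]
  ring

lemma integral_div_sub_mul_rhoMP (hd : 0 < d) (hd1 : d < 1) (hc : c < aMP d) :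
    ∫ x in aMP d..bMP d, (c / (x - c)) * rhoMP d x
      = (1 - d - c - √((aMP d - c) * (bMP d - c))) / (2 * d) := by
  have hab := aMP_lt_bMP hd
  have ha := aMP_pos hd1
  have hI := intervalIntegrable_sqrt_div hc hab 1
  have hI0 := intervalIntegrable_sqrt_div ha hab 1
  simp only [pow_one, sub_zero] at hI hI0
  have heq : ∫ x in aMP d..bMP d, (c / (x - c)) * rhoMP d x
      = ∫ x in aMP d..bMP d, 1 / (2 * π * d) * (√((bMP d - x) * (x - aMP d)) / (x - c)
        - √((bMP d - x) * (x - aMP d)) / x) := by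
    refine intervalIntegral.integral_congr fun x hx => ?_
    rw [uIcc_of_le hab.le] at hx
    have h1 : x - c ≠ 0 := by linarith [hx.1]
    have h2 : x ≠ 0 := by linarith [hx.1]
    simp only [rhoMP_of_mem hx]
    field_simp
    ring
  rw [heq, intervalIntegral.integral_const_mul, intervalIntegral.integral_sub hI hI0,
    integral_sqrt_div_self hd hd1, integral_sqrt_div_sub hc hab, aMP_add_bMP hd.le]
  field_simp
  ring

lemma integral_div_sub_sq_mul_rhoMP (hd : 0 < d) (hd1 : d < 1) (hc : c < aMP d) :
    ∫ x in aMP d..bMP d, (c / (x - c)) ^ 2 * rhoMP d x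
      = (√((aMP d - c) * (bMP d - c)) - (1 - d)
          + c * (1 + d - c) / √((aMP d - c) * (bMP d - c))) / (2 * d) := by
  have hab := aMP_lt_bMP hd
  have ha := aMP_pos hd1
  have hI := intervalIntegrable_sqrt_div hc hab 1
  have hI2 := (intervalIntegrable_sqrt_div hc hab 2).const_mul c
  have hI0 := intervalIntegrable_sqrt_div ha hab 1
  simp only [pow_one, sub_zero] at hI hI0
  have heq : ∫ x in aMP d..bMP d, (c / (x - c)) ^ 2 * rhoMP d x
      = ∫ x in aMP d..bMP d, 1 / (2 * π * d) * (√((bMP d - x) * (x - aMP d)) / x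
        - √((bMP d - x) * (x - aMP d)) / (x - c)
        + c * (√((bMP d - x) * (x - aMP d)) / (x - c) ^ 2)) := by
    refine intervalIntegral.integral_congr fun x hx => ?_
    rw [uIcc_of_le hab.le] at hx
    have h1 : x - c ≠ 0 := by linarith [hx.1]
    have h2 : x ≠ 0 := by linarith [hx.1]
    simp only [rhoMP_of_mem hx]
    field_simp
    ring
  have hP : 0 < (aMP d - c) * (bMP d - c) := mul_pos (by linarith) (by linarith)
  have := (Real.sqrt_pos.2 hP).ne'
  rw [heq, intervalIntegral.integral_const_mul,
    intervalIntegral.integral_add (hI0.sub hI) hI2, intervalIntegral.integral_sub hI0 hI,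
    intervalIntegral.integral_const_mul,
    integral_sqrt_div_self hd hd1, integral_sqrt_div_sub hc hab, integral_sqrt_div_sub_sq hc hab,
    aMP_add_bMP hd.le]
  field_simp
  ring

end MarchenkoPastur

/-- The function of `x = m / p`, `y = n / p` and the shift `h` of all parameters whose values are
`(m / n) * μ_J` at `h = 1 / (2 * p)` and `μ` at `h = 0`. -/
noncomputable def shiftedCentering (x y h : ℝ) : ℝ :=
  x / y * ((√((1 - h) * (x - h)) + √((y - h) * (x + y - 1 - h))) /
    (√((x + y - 1 - h) * (x - h)) - √((1 - h) * (y - h)))) ^ 2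

lemma centering_eq_sq {c d e : ℝ} (hd : 0 < d) (hd1 : d < 1) (he : 0 < e)
    (hc : c ∈ Ioo 0 (aMP d))
    (h : ∫ x in aMP d..bMP d, (c / (x - c)) ^ 2 * rhoMP d x = 1 / e) :
    1 / c * (1 + e * ∫ x in aMP d..bMP d, (c / (x - c)) * rhoMP d x)
      = ((√(e + d - e * d) + e) / (√(e + d - e * d) - d)) ^ 2 := by
  obtain ⟨hc0, hca⟩ := hc
  have hP : 0 < (aMP d - c) * (bMP d - c) :=
    mul_pos (by linarith) (by linarith [aMP_lt_bMP hd])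
  rw [integral_div_sub_sq_mul_rhoMP hd hd1 hca] at h
  rw [integral_div_sub_mul_rhoMP hd hd1 hca]
  set D := √((aMP d - c) * (bMP d - c)) with hD
  have hD0 : 0 < D := Real.sqrt_pos.2 hP
  have hD2 : D ^ 2 = (1 - d) ^ 2 - 2 * c * (1 + d) + c ^ 2 := by
    rw [hD, Real.sq_sqrt hP.le, ← aMP_mul_bMP hd.le]
    linear_combination (-c) * aMP_add_bMP hd.le
  clear_value D
  have hlt : D < 1 - d - c := by
    refine lt_of_pow_lt_pow_left₀ 2 (by linarith [aMP_lt_one_sub hd hd1]) ?_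
    nlinarith [mul_pos hd hc0]
  obtain ⟨t, ht⟩ : ∃ t, t = (1 - d - c - D) / (2 * d) := ⟨_, rfl⟩
  have ht0 : 0 < t := ht ▸ div_pos (by linarith) (by linarith)
  rw [← ht]
  have hDt : D = 1 - d - c - 2 * d * t := by rw [ht]; field_simp; ring
  have hct : c * (1 + t) = t * (1 - d - d * t) := by
    rw [hDt] at hD2
    have : 4 * d * (c * (1 + t) - t * (1 - d - d * t)) = 0 := by linear_combination hD2
    have := (mul_eq_zero.1 this).resolve_left (by positivity)
    linarith
  have hDw : D * (1 + t) = 1 - d * (1 + t) ^ 2 := by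
    rw [hDt]; linear_combination -hct
  have hquad : e * t ^ 2 = 1 - d * (1 + t) ^ 2 := by
    have hce : c = t * (1 - d - d * t) / (1 + t) := by field_simp; linarith
    have h' : e * (D ^ 2 - (1 - d) * D + c * (1 + d - c)) = 2 * d * D := by
      field_simp at h
      linarith
    have hDe : D = (1 - d * (1 + t) ^ 2) / (1 + t) := by field_simp; linarith
    have hmul : 2 * d * (e * t ^ 2) = 2 * d * (D * (1 + t)) := by
      have h2 : D ^ 2 - (1 - d) * D + c * (1 + d - c) = 2 * d * t ^ 2 / (1 + t) := by
        rw [hce, hDe]; field_simp; ring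
      rw [h2] at h'
      field_simp at h'
      linear_combination 2 * d * h'
    rw [← hDw]
    exact mul_left_cancel₀ (by positivity) hmul
  have hr : √(e + d - e * d) = (e + d) * (1 + t) - e := by
    rw [Real.sqrt_eq_iff_mul_self_eq_of_pos (by nlinarith [mul_pos he ht0, mul_pos hd ht0])]
    linear_combination (e + d) * hquad
  have hdt : 0 < 1 - d - d * t := by
    by_contra hneg
    nlinarith [mul_pos hc0 (add_pos one_pos ht0), mul_nonneg ht0.le (sub_nonneg.2 (not_lt.1 hneg))]
  have hce : c = t * (1 - d - d * t) / (1 + t) := by field_simp; linarith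
  rw [hr, hce]
  have h1 : (e + d) * (1 + t) - e + e = (e + d) * (1 + t) := by ring
  have h2 : (e + d) * (1 + t) - e - d = (e + d) * t := by ring
  rw [h1, h2]
  have hq : t * (1 + e * t) = (1 + t) * (1 - d - d * t) := by linear_combination hquad
  generalize 1 - d - d * t = q at *
  field_simp
  linear_combination hq

lemma shiftedCentering_zero {x y : ℝ} (hx : 1 < x) (hy : 0 < y) :
    shiftedCentering x y 0 =
      ((√(1 / y + 1 / x - 1 / y * (1 / x)) + 1 / y) /
        (√(1 / y + 1 / x - 1 / y * (1 / x)) - 1 / x)) ^ 2 := by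
  have hx0 : 0 < x := by linarith
  have hz : 0 < x + y - 1 := by linarith
  have e1 : 1 / y + 1 / x - 1 / y * (1 / x) = (x + y - 1) / (x * y) := by field_simp
  have hs : √((x + y - 1) / (x * y)) = √(x + y - 1) / (√x * √y) := by
    rw [Real.sqrt_div hz.le, Real.sqrt_mul hx0.le]
  rw [e1, hs]
  unfold shiftedCentering
  simp only [sub_zero, one_mul]
  rw [Real.sqrt_mul hy.le, Real.sqrt_mul hz.le]
  have hX := Real.sq_sqrt hx0.le
  have hY := Real.sq_sqrt hy.le
  have hZ := Real.sq_sqrt hz.le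
  have hX0 := Real.sqrt_pos.2 hx0
  have hY0 := Real.sqrt_pos.2 hy
  have hZ0 := Real.sqrt_pos.2 hz
  have hden : √y < √(x + y - 1) * √x := by
    rw [← Real.sqrt_mul hz.le]
    exact Real.sqrt_lt_sqrt hy.le (by nlinarith)
  generalize √x = X at *
  generalize √y = Y at *
  generalize √(x + y - 1) = Z at *
  rw [← hX, ← hY]
  have h1 : Z * X - Y ≠ 0 := by linarith
  have h2 : Z / (X * Y) + 1 / Y ^ 2 = (X + Y * Z) / (X * Y ^ 2) := by field_simp; ring
  have h3 : Z / (X * Y) - 1 / X ^ 2 = (Z * X - Y) / (X ^ 2 * Y) := by field_simp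
  rw [h2, h3]
  field_simp

lemma shiftedCentering_of_sin_sq {x y h α β : ℝ} (hx : h < x) (hy : h < y)
    (hα : α ∈ Ioo 0 (π / 2)) (hβ : β ∈ Ioo 0 (π / 2))
    (hsα : sin α ^ 2 = (1 - h) / (x + y - 2 * h)) (hsβ : sin β ^ 2 = (y - h) / (x + y - 2 * h)) :
    x / y * tan (α + β) ^ 2 = shiftedCentering x y h := by
  have hν : 0 < x + y - 2 * h := by linarith
  have hcα : cos α ^ 2 = (x + y - 1 - h) / (x + y - 2 * h) := by
    rw [cos_sq', hsα, eq_div_iff hν.ne', sub_mul, div_mul_cancel₀ _ hν.ne']; ring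
  have hcβ : cos β ^ 2 = (x - h) / (x + y - 2 * h) := by
    rw [cos_sq', hsβ, eq_div_iff hν.ne', sub_mul, div_mul_cancel₀ _ hν.ne']; ring
  have sα : 0 < sin α := sin_pos_of_pos_of_lt_pi hα.1 (by linarith [hα.2, pi_pos])
  have sβ : 0 < sin β := sin_pos_of_pos_of_lt_pi hβ.1 (by linarith [hβ.2, pi_pos])
  have cα : 0 < cos α := cos_pos_of_mem_Ioo ⟨by linarith [hα.1, pi_pos], hα.2⟩
  have cβ : 0 < cos β := cos_pos_of_mem_Ioo ⟨by linarith [hβ.1, pi_pos], hβ.2⟩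
  have key : ∀ {u v A B : ℝ}, 0 < u → 0 < v → u ^ 2 = A / (x + y - 2 * h) →
      v ^ 2 = B / (x + y - 2 * h) → √(A * B) = (x + y - 2 * h) * (u * v) := by
    intro u v A B hu hv hA hB
    rw [Real.sqrt_eq_iff_mul_self_eq_of_pos (by positivity)]
    rw [eq_div_iff hν.ne'] at hA hB
    rw [← hA, ← hB]
    ring
  unfold shiftedCentering
  rw [key sα cβ hsα hcβ, key sβ cα hsβ hcα, key cα cβ hcα hcβ, key sα sβ hsα hsβ, ← mul_add,
    ← mul_sub, mul_div_mul_left _ _ hν.ne', tan_eq_sin_div_cos, sin_add, cos_add,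
    mul_comm (sin β)]

lemma contDiffAt_shiftedCentering {x y : ℝ} (hx : 1 < x) (hy : 0 < y) :
    ContDiffAt ℝ 1 (fun q : ℝ × ℝ × ℝ => shiftedCentering q.1 q.2.1 q.2.2) (x, y, 0) := by
  have hx0 : 0 < x := by linarith
  have hz : 0 < x + y - 1 := by linarith
  have hden : √y < √((x + y - 1) * x) := Real.sqrt_lt_sqrt hy.le (by nlinarith)
  unfold shiftedCentering
  refine ContDiffAt.mul (ContDiffAt.div (by fun_prop) (by fun_prop) hy.ne') (ContDiffAt.pow
    (ContDiffAt.div (ContDiffAt.add (ContDiffAt.sqrt (by fun_prop) ?_)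
      (ContDiffAt.sqrt (by fun_prop) ?_)) (ContDiffAt.sub (ContDiffAt.sqrt (by fun_prop) ?_)
      (ContDiffAt.sqrt (by fun_prop) ?_)) ?_) 2)
  all_goals simp only [sub_zero, one_mul]
  · exact hx0.ne'
  · positivity
  · positivity
  · exact hy.ne'
  · linarith

lemma exists_abs_shiftedCentering_sub_le {x₀ y₀ : ℝ} (hx : 1 < x₀) (hy : 0 < y₀)
    {x y h : ℕ → ℝ} (tx : Tendsto x atTop (𝓝 x₀)) (ty : Tendsto y atTop (𝓝 y₀))
    (th : Tendsto h atTop (𝓝 0)) :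
    ∃ K : ℝ, ∀ᶠ p in atTop,
      |shiftedCentering (x p) (y p) (h p) - shiftedCentering (x p) (y p) 0| ≤ K * |h p| := by
  obtain ⟨K, t, ht, hK⟩ := (contDiffAt_shiftedCentering hx hy).exists_lipschitzOnWith
  refine ⟨K, ?_⟩
  have t1 : Tendsto (fun p => (x p, y p, h p)) atTop (𝓝 (x₀, y₀, 0)) :=
    tx.prodMk_nhds (ty.prodMk_nhds th)
  have t2 : Tendsto (fun p => (x p, y p, (0 : ℝ))) atTop (𝓝 (x₀, y₀, 0)) :=
    tx.prodMk_nhds (ty.prodMk_nhds tendsto_const_nhds)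
  filter_upwards [t1.eventually ht, t2.eventually ht] with p h1 h2
  have := hK.dist_le_mul _ h1 _ h2
  simpa [Prod.dist_eq, Real.dist_eq] using this

end Centering

/-- under Condition 3 with `0 < d₁ < 1`, there is a constant `M` with
`|(m/n)·μ_{J,p} − μ_p| ≤ M/p` for all large `p`; in particular
`p^{2/3}·|(m/n)·μ_{J,p} − μ_p| → 0`. -/
theorem stmt_5 (m n : ℕ → ℕ) (d₁ d₂ d₃ : ℝ)
    (hd₁ : d₁ ∈ Set.Ioo (0 : ℝ) 1) (hd₂ : 0 < d₂) (hd₃ : d₃ ∈ Set.Ioo (0 : ℝ) 1)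
    (hm : Tendsto (fun p : ℕ => (p : ℝ) / m p) atTop (nhds d₁))
    (hn : Tendsto (fun p : ℕ => (p : ℝ) / n p) atTop (nhds d₂))
    (hmn : Tendsto (fun p : ℕ => (p : ℝ) / ((m p : ℝ) + n p)) atTop (nhds d₃))
    (c : ℕ → ℝ)
    (hc : ∀ᶠ p : ℕ in atTop,
      c p ∈ Set.Ioo 0 (aMP ((p : ℝ) / m p)) ∧
      (∫ x in (aMP ((p : ℝ) / m p))..(bMP ((p : ℝ) / m p)),
          (c p / (x - c p)) ^ 2 * rhoMP ((p : ℝ) / m p) x) = (n p : ℝ) / p)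
    (μ : ℕ → ℝ)
    (hμ : ∀ p, μ p = (1 / c p) * (1 + ((p : ℝ) / n p) *
        ∫ x in (aMP ((p : ℝ) / m p))..(bMP ((p : ℝ) / m p)),
          (c p / (x - c p)) * rhoMP ((p : ℝ) / m p) x))
    (γ ψ : ℕ → ℝ)
    (hγ : ∀ᶠ p : ℕ in atTop, γ p ∈ Set.Ioo 0 Real.pi ∧
      Real.sin (γ p / 2) ^ 2 = ((min p (n p) : ℝ) - 1 / 2) / ((m p : ℝ) + n p - 1))
    (hψ : ∀ᶠ p : ℕ in atTop, ψ p ∈ Set.Ioo 0 Real.pi ∧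
      Real.sin (ψ p / 2) ^ 2 = ((max p (n p) : ℝ) - 1 / 2) / ((m p : ℝ) + n p - 1))
    (μJ : ℕ → ℝ)
    (hμJ : ∀ p, μJ p = Real.tan ((γ p + ψ p) / 2) ^ 2) :
    (∃ M : ℝ, ∀ᶠ p : ℕ in atTop,
        |((m p : ℝ) / n p) * μJ p - μ p| ≤ M / p) ∧
      Tendsto (fun p : ℕ => (p : ℝ) ^ ((2 : ℝ) / 3) * |((m p : ℝ) / n p) * μJ p - μ p|)
        atTop (nhds 0) := by
  have hx₀ : 1 < d₁⁻¹ := (one_lt_inv₀ hd₁.1).2 hd₁.2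
  have hy₀ : 0 < d₂⁻¹ := inv_pos.2 hd₂
  have tx : Tendsto (fun p : ℕ => (m p : ℝ) / p) atTop (nhds d₁⁻¹) := by
    simpa using hm.inv₀ hd₁.1.ne'
  have ty : Tendsto (fun p : ℕ => (n p : ℝ) / p) atTop (nhds d₂⁻¹) := by
    simpa using hn.inv₀ hd₂.ne'
  have th : Tendsto (fun p : ℕ => 1 / (2 * (p : ℝ))) atTop (nhds 0) :=
    tendsto_const_nhds.div_atTop
      (tendsto_natCast_atTop_atTop.const_mul_atTop (two_pos : (0 : ℝ) < 2))
  obtain ⟨K, hK⟩ := exists_abs_shiftedCentering_sub_le hx₀ hy₀ tx ty th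
  have hbound : ∀ᶠ p : ℕ in atTop, |((m p : ℝ) / n p) * μJ p - μ p| ≤ (K / 2) / p := by
    filter_upwards [hK, hc, hγ, hψ, tx.eventually_const_lt hx₀, ty.eventually_const_lt hy₀,
      th.eventually_lt tx (by linarith), th.eventually_lt ty hy₀, eventually_gt_atTop 0]
      with p hK hc hγ hψ hx1 hy0 hx hy hp
    have hp' : (0 : ℝ) < p := by exact_mod_cast hp
    have hm0 : (0 : ℝ) < m p := by
      rw [lt_div_iff₀ hp'] at hx1; linarith
    have hn0 : (0 : ℝ) < n p := by
      rw [lt_div_iff₀ hp'] at hy0; linarith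
    set x := (m p : ℝ) / p with hxdef
    set y := (n p : ℝ) / p with hydef
    set h := 1 / (2 * (p : ℝ)) with hhdef
    have hpx : (p : ℝ) / m p = 1 / x := by rw [hxdef, one_div_div]
    have hpy : (p : ℝ) / n p = 1 / y := by rw [hydef, one_div_div]
    have hxy : (m p : ℝ) / n p = x / y := by
      rw [hxdef, hydef, div_div_div_cancel_right₀ hp'.ne']
    have hν : (m p : ℝ) + n p - 1 = p * (x + y - 2 * h) := by
      rw [hxdef, hydef, hhdef]; field_simp
    have hp1 : ((p : ℝ) - 1 / 2) / ((m p : ℝ) + n p - 1) = (1 - h) / (x + y - 2 * h) := by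
      have : (p : ℝ) - 1 / 2 = p * (1 - h) := by rw [hhdef]; field_simp
      rw [this, hν, mul_div_mul_left _ _ hp'.ne']
    have hn1 : ((n p : ℝ) - 1 / 2) / ((m p : ℝ) + n p - 1) = (y - h) / (x + y - 2 * h) := by
      have : (n p : ℝ) - 1 / 2 = p * (y - h) := by rw [hydef, hhdef]; field_simp
      rw [this, hν, mul_div_mul_left _ _ hp'.ne']
    have hJ : ((m p : ℝ) / n p) * μJ p = shiftedCentering x y h := by
      have hγ' : γ p / 2 ∈ Set.Ioo 0 (Real.pi / 2) :=
        ⟨by linarith [hγ.1.1], by linarith [hγ.1.2]⟩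
      have hψ' : ψ p / 2 ∈ Set.Ioo 0 (Real.pi / 2) :=
        ⟨by linarith [hψ.1.1], by linarith [hψ.1.2]⟩
      rw [hμJ, hxy, add_div]
      have h2 := hγ.2
      have h3 := hψ.2
      rcases le_total (p : ℝ) (n p) with hle | hle
      · rw [min_eq_left hle, hp1] at h2
        rw [max_eq_right hle, hn1] at h3
        exact shiftedCentering_of_sin_sq hx hy hγ' hψ' h2 h3
      · rw [min_eq_right hle, hn1] at h2
        rw [max_eq_left hle, hp1] at h3
        rw [add_comm]
        exact shiftedCentering_of_sin_sq hx hy hψ' hγ' h3 h2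
    have hμp : μ p = shiftedCentering x y 0 := by
      have hx0 : 0 < x := by linarith
      rw [hμ, shiftedCentering_zero hx1 hy0, hpx, hpy]
      rw [hpx] at hc
      refine centering_eq_sq (by positivity) ((div_lt_one hx0).2 hx1) (by positivity) hc.1 ?_
      rw [hc.2, one_div_one_div]
    rw [hJ, hμp]
    refine hK.trans (le_of_eq ?_)
    rw [abs_of_pos (by positivity), hhdef]
    field_simp
  refine ⟨⟨K / 2, hbound⟩, ?_⟩
  have hlim : Tendsto (fun p : ℕ => K / 2 * (p : ℝ) ^ (-(1 / 3) : ℝ)) atTop (nhds 0) := by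
    simpa using ((tendsto_rpow_neg_atTop (by norm_num : (0 : ℝ) < 1 / 3)).comp
      tendsto_natCast_atTop_atTop).const_mul (K / 2)
  refine squeeze_zero' (Eventually.of_forall fun p => by positivity) ?_ hlim
  filter_upwards [hbound, eventually_gt_atTop 0] with p hb hp
  have hp' : (0 : ℝ) < p := by exact_mod_cast hp
  calc (p : ℝ) ^ ((2 : ℝ) / 3) * |((m p : ℝ) / n p) * μJ p - μ p|
      ≤ (p : ℝ) ^ ((2 : ℝ) / 3) * ((K / 2) / p) := by gcongr
    _ = K / 2 * ((p : ℝ) ^ ((2 : ℝ) / 3) / (p : ℝ) ^ (1 : ℝ)) := by rw [Real.rpow_one]; ring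
    _ = K / 2 * (p : ℝ) ^ (-(1 / 3) : ℝ) := by rw [← Real.rpow_sub hp']; norm_num
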